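/- (Theorem 5, first part: every voxel in a tile constructed from a boundary interior voxel is free.) Let occ : ℤ³ → S be an occupancy map, let e be an axis direction, let b ∈ ℤ³ be a boundary interior voxel, and let r ≥ 1 be an integer. Assume that for every integer i with 1 ≤ i ≤ r the voxel b + i·e is not a boundary voxel. Then occ(b + i·e) = free for every integer i with 1 ≤ i ≤ r. -/

import Mathlib

inductive OccState : Type
  | free | occupied | unknown
deriving DecidableEq

abbrev Voxel := ℤ × ℤ × ℤ

/-- Two voxels are 6-neighbors iff their ℓ¹ distance is 1. -/
def sixNbr (m n : Voxel) : Prop :=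
  |m.1 - n.1| + |m.2.1 - n.2.1| + |m.2.2 - n.2.2| = 1

/-- Boundary interior voxel: free, with a 6-neighbor that is unknown or occupied. -/
def bdInt (occ : Voxel → OccState) (n : Voxel) : Prop :=
  occ n = OccState.free ∧
    ∃ m, sixNbr m n ∧ (occ m = OccState.unknown ∨ occ m = OccState.occupied)

/-- Boundary exterior (unknown) voxel: unknown, with a free 6-neighbor. -/
def bdUkn (occ : Voxel → OccState) (n : Voxel) : Prop :=
  occ n = OccState.unknown ∧ ∃ m, sixNbr m n ∧ occ m = OccState.free

/-- Boundary exterior (occupied) voxel: any occupied voxel. -/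
def bdOcc (occ : Voxel → OccState) (n : Voxel) : Prop :=
  occ n = OccState.occupied

/-- Boundary voxel. -/
def bdVoxel (occ : Voxel → OccState) (n : Voxel) : Prop :=
  bdInt occ n ∨ bdUkn occ n ∨ bdOcc occ n

/-- An axis direction: exactly one nonzero coordinate, equal to ±1 (ℓ¹ norm 1). -/
def axisDir (e : Voxel) : Prop :=
  |e.1| + |e.2.1| + |e.2.2| = 1

/-- Translating a voxel by an axis direction gives a 6-neighbor. -/
theorem sixNbr_add_axisDir {e : Voxel} (he : axisDir e) (v : Voxel) : sixNbr v (v + e) := by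
  simpa [sixNbr, axisDir] using he

/-- A non-boundary voxel with a free 6-neighbor is free. -/
theorem free_of_sixNbr_free {occ : Voxel → OccState} {m n : Voxel} (hmn : sixNbr m n)
    (hm : occ m = OccState.free) (hn : ¬ bdVoxel occ n) : occ n = OccState.free := by
  cases h : occ n with
  | free => rfl
  | occupied => exact absurd (Or.inr (Or.inr h)) hn
  | unknown => exact absurd (Or.inr (Or.inl ⟨h, m, hmn, hm⟩)) hn

theorem stmt7 (occ : Voxel → OccState) (e : Voxel) (he : axisDir e)
    (b : Voxel) (hb : bdInt occ b) (r : ℤ) (hr : 1 ≤ r)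
    (hnb : ∀ i : ℤ, 1 ≤ i → i ≤ r → ¬ bdVoxel occ (b + i • e)) :
    ∀ i : ℤ, 1 ≤ i → i ≤ r → occ (b + i • e) = OccState.free := by
  intro i hi
  induction i, hi using Int.leInduction with
  | base =>
    intro h
    refine free_of_sixNbr_free ?_ hb.1 (hnb 1 le_rfl h)
    simpa using sixNbr_add_axisDir he b
  | succ i hi ih =>
    intro h
    refine free_of_sixNbr_free ?_ (ih (by lia)) (hnb (i + 1) (by lia) h)
    simpa [add_smul, add_assoc] using sixNbr_add_axisDir he (b + i • e)
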